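/- Let β ∈ (1, 2). Let X and Y be random variables with values in separable metric spaces (𝒳, d) and (𝒴, d), Z := (X, Y), θ := L(Z), and θₙ the empirical measure of Z₁, ..., Zₙ, where (Z_k)_{k∈ℕ} is a strictly stationary and ergodic sequence with L(Z₁) = θ. If X and Y have finite β-moments, i.e. E d(X, x₀)^β < ∞ and E d(Y, y₀)^β < ∞, then dcov_β(θₙ) → dcov_β(θ) almost surely as n → ∞. -/

import Mathlib

open MeasureTheory Filter Topology
open scoped ENNReal

noncomputable section

/-- The shift map on path space. -/
def shift {𝒵 : Type*} (x : ℕ → 𝒵) : ℕ → 𝒵 := fun i => x (i + 1)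

/-- Empirical measure of `Z₁, …, Zₙ` (indexed here as `Z 0, …, Z (n-1)`). -/
def emp {Ω 𝒵 : Type*} [MeasurableSpace 𝒵] (Z : ℕ → Ω → 𝒵) (n : ℕ) (ω : Ω) : Measure 𝒵 :=
  (n : ℝ≥0∞)⁻¹ • ∑ k ∈ Finset.range n, Measure.dirac (Z k ω)

/-- `a_μ(x) = ∫ ρ(x,x') dμ(x')`. -/
def aM {X : Type*} [MeasurableSpace X] (ρ : X → X → ℝ) (μ : Measure X) (x : X) : ℝ :=
  ∫ x', ρ x x' ∂μ

/-- `D(μ) = ∫ ρ(x,x') dμ²(x,x')`. -/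
def DM {X : Type*} [MeasurableSpace X] (ρ : X → X → ℝ) (μ : Measure X) : ℝ :=
  ∫ p : X × X, ρ p.1 p.2 ∂(μ.prod μ)

/-- `d_μ(x,x') = ρ(x,x') - a_μ(x) - a_μ(x') + D(μ)`. -/
def dM {X : Type*} [MeasurableSpace X] (ρ : X → X → ℝ) (μ : Measure X) (x x' : X) : ℝ :=
  ρ x x' - aM ρ μ x - aM ρ μ x' + DM ρ μ

/-- `δ_θ(z,z') = d_μ(x,x') d_ν(y,y')` where `μ, ν` are the marginals of `θ`. -/
def deltaTheta {X Y : Type*} [MeasurableSpace X] [MeasurableSpace Y]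
    (ρX : X → X → ℝ) (ρY : Y → Y → ℝ) (θ : Measure (X × Y)) (z z' : X × Y) : ℝ :=
  dM ρX (θ.map Prod.fst) z.1 z'.1 * dM ρY (θ.map Prod.snd) z.2 z'.2

/-- The distance covariance `dcov(θ) = ∫ δ_θ dθ²` w.r.t. the (pseudo)metrics `ρX, ρY`;
for `ρX = dX^β`, `ρY = dY^β` this is `dcov_β(θ)`. -/
def dcov {X Y : Type*} [MeasurableSpace X] [MeasurableSpace Y]
    (ρX : X → X → ℝ) (ρY : Y → Y → ℝ) (θ : Measure (X × Y)) : ℝ :=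
  ∫ p : (X × Y) × (X × Y), deltaTheta ρX ρY θ p.1 p.2 ∂(θ.prod θ)

/-! ### Birkhoff's pointwise ergodic theorem for ergodic maps -/

def mxB {α : Type*} (T : α → α) (g : α → ℝ) : ℕ → α → ℝ
  | 0, _ => 0
  | n + 1, x => max 0 (g x + mxB T g n (T x))

lemma mxB_nonneg {α : Type*} (T : α → α) (g : α → ℝ) (n : ℕ) (x : α) : 0 ≤ mxB T g n x := by
  cases n with
  | zero => simp [mxB]
  | succ n => simp [mxB]

lemma mxB_le_succ {α : Type*} (T : α → α) (g : α → ℝ) (n : ℕ) :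
    ∀ x, mxB T g n x ≤ mxB T g (n + 1) x := by
  induction n with
  | zero => intro x; simp [mxB]
  | succ n ih =>
    intro x
    have := ih (T x)
    show max 0 (g x + mxB T g n (T x)) ≤ max 0 (g x + mxB T g (n + 1) (T x))
    gcongr

lemma mxB_mono {α : Type*} (T : α → α) (g : α → ℝ) (x : α) : Monotone fun n => mxB T g n x :=
  monotone_nat_of_le_succ fun n => mxB_le_succ T g n x

lemma sum_le_mxB {α : Type*} (T : α → α) (g : α → ℝ) (n : ℕ) :
    ∀ x, ∑ k ∈ Finset.range n, g (T^[k] x) ≤ mxB T g n x := by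
  induction n with
  | zero => intro x; simp [mxB]
  | succ n ih =>
    intro x
    rw [Finset.sum_range_succ']
    have := ih (T x)
    simp only [Function.iterate_succ_apply, Function.iterate_zero, id] at *
    refine le_trans ?_ (le_max_right _ _)
    linarith

lemma mxB_measurable {α : Type*} [MeasurableSpace α] {T : α → α} {g : α → ℝ}
    (hT : Measurable T) (hg : Measurable g) (n : ℕ) : Measurable (mxB T g n) := by
  induction n with
  | zero => exact measurable_const
  | succ n ih => exact measurable_const.max (hg.add (ih.comp hT))

lemma mxB_integrable {α : Type*} [MeasurableSpace α] {μ : Measure α} [IsProbabilityMeasure μ]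
    {T : α → α} {g : α → ℝ}
    (hT : MeasurePreserving T μ μ) (hg : Integrable g μ) (n : ℕ) : Integrable (mxB T g n) μ := by
  induction n with
  | zero => exact integrable_const 0
  | succ n ih =>
    exact (integrable_const (0 : ℝ)).sup (hg.add (hT.integrable_comp_of_integrable ih))

lemma mxB_bdd {α : Type*} [MeasurableSpace α] {μ : Measure α} [IsProbabilityMeasure μ]
    {T : α → α} {g : α → ℝ} (hT : Ergodic T μ) (hgm : Measurable g) (hg : Integrable g μ)
    (hneg : ∫ x, g x ∂μ < 0) :
    ∀ᵐ x ∂μ, ∃ K : ℝ, ∀ n, mxB T g n x ≤ K := by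
  have hTp := hT.toMeasurePreserving
  set A : Set α := {x | ∀ K : ℕ, ∃ n, (K : ℝ) < mxB T g n x} with hA
  have hAm : MeasurableSet A := by
    have : A = ⋂ K : ℕ, ⋃ n, {x | (K : ℝ) < mxB T g n x} := by ext; simp [hA]
    rw [this]
    exact MeasurableSet.iInter fun K => MeasurableSet.iUnion fun n =>
      measurableSet_lt measurable_const (mxB_measurable hTp.measurable hgm n)
  have hAinv : T ⁻¹' A = A := by
    ext x
    simp only [hA, Set.mem_preimage, Set.mem_ofPred_eq]
    constructor
    · intro h K
      obtain ⟨L, hL⟩ := exists_nat_gt ((K : ℝ) - g x)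
      obtain ⟨n, hn⟩ := h L
      refine ⟨n + 1, lt_of_lt_of_le ?_ (le_max_right _ _)⟩
      linarith
    · intro h K
      obtain ⟨L, hL⟩ := exists_nat_gt ((K : ℝ) + g x)
      obtain ⟨n, hn⟩ := h L
      refine ⟨n, ?_⟩
      have h1 := hn.trans_le (mxB_le_succ T g n x)
      have h0 : (0 : ℝ) ≤ L := Nat.cast_nonneg _
      rcases lt_max_iff.1 h1 with h2 | h2
      · linarith
      · linarith
  rcases hT.toPreErgodic.ae_mem_or_ae_notMem hAm hAinv with h | h
  · exfalso
    have hlim : Tendsto (fun n => ∫ x, (mxB T g (n + 1) x - mxB T g n (T x)) ∂μ) atTop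
        (𝓝 (∫ x, g x ∂μ)) := by
      refine tendsto_integral_of_dominated_convergence (fun x => |g x|) ?_ hg.abs ?_ ?_
      · intro n
        exact ((mxB_measurable hTp.measurable hgm (n + 1)).sub
          ((mxB_measurable hTp.measurable hgm n).comp hTp.measurable)).aestronglyMeasurable
      · intro n
        refine Eventually.of_forall fun x => ?_
        have h0 := mxB_nonneg T g n (T x)
        simp only [mxB, Real.norm_eq_abs]
        rcases le_total 0 (g x + mxB T g n (T x)) with h1 | h1
        · rw [max_eq_right h1]; simp
        · rw [max_eq_left h1, zero_sub, abs_neg, abs_of_nonneg h0]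
          have := neg_abs_le (g x)
          have := neg_le_abs (g x)
          linarith
      · filter_upwards [h] with x hx
        have hx' : T x ∈ A := by
          have : x ∈ T ⁻¹' A := by rw [hAinv]; exact hx
          exact this
        obtain ⟨L, hL⟩ := exists_nat_gt (- g x)
        obtain ⟨n, hn⟩ := hx' L
        refine tendsto_const_nhds.congr' ?_
        filter_upwards [eventually_ge_atTop n] with k hk
        have h2 : mxB T g n (T x) ≤ mxB T g k (T x) := mxB_mono T g (T x) hk
        simp only [mxB]
        rw [max_eq_right (by linarith)]
        ring
    have hge : ∀ n, 0 ≤ ∫ x, (mxB T g (n + 1) x - mxB T g n (T x)) ∂μ := by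
      intro n
      have hi : Integrable (fun x => mxB T g n (T x)) μ :=
        hTp.integrable_comp_of_integrable (mxB_integrable hTp hg n)
      rw [integral_sub (mxB_integrable hTp hg _) hi]
      have : ∫ x, mxB T g n (T x) ∂μ = ∫ x, mxB T g n x ∂μ := by
        have h3 := integral_map (μ := μ) hTp.measurable.aemeasurable
          (f := mxB T g n) (mxB_measurable hTp.measurable hgm n).aestronglyMeasurable
        rw [hTp.map_eq] at h3
        exact h3.symm
      rw [this, sub_nonneg]
      exact integral_mono (mxB_integrable hTp hg _) (mxB_integrable hTp hg _)
        (mxB_le_succ T g n)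
    have := ge_of_tendsto' hlim hge
    linarith
  · filter_upwards [h] with x hx
    simp only [hA, Set.mem_ofPred_eq] at hx
    push Not at hx
    obtain ⟨K, hK⟩ := hx
    exact ⟨K, hK⟩

lemma birkhoff_upper {α : Type*} [MeasurableSpace α] {μ : Measure α} [IsProbabilityMeasure μ]
    {T : α → α} {g : α → ℝ} (hT : Ergodic T μ) (hgm : Measurable g) (hg : Integrable g μ) :
    ∀ᵐ x ∂μ, ∀ c : ℝ, ∫ x, g x ∂μ < c →
      ∀ᶠ n : ℕ in atTop, (∑ k ∈ Finset.range n, g (T^[k] x)) / n < c := by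
  have key : ∀ m : ℕ, ∀ᵐ x ∂μ, ∃ K : ℝ, ∀ n : ℕ,
      ∑ k ∈ Finset.range n, g (T^[k] x) ≤ n * (∫ x, g x ∂μ + 1 / ((m : ℝ) + 1)) + K := by
    intro m
    have hpos : 0 < 1 / ((m : ℝ) + 1) := by positivity
    have h := mxB_bdd (μ := μ) (T := T) (g := fun x => g x - (∫ x, g x ∂μ + 1 / ((m : ℝ) + 1))) hT
      (hgm.sub measurable_const) (hg.sub (integrable_const _)) (by
        rw [integral_sub hg (integrable_const _)]
        simp
        positivity)
    filter_upwards [h] with x ⟨K, hK⟩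
    refine ⟨K, fun n => ?_⟩
    have h1 := (sum_le_mxB T (fun x => g x - (∫ x, g x ∂μ + 1 / ((m : ℝ) + 1))) n x).trans (hK n)
    simp only [Finset.sum_sub_distrib, Finset.sum_const, Finset.card_range, nsmul_eq_mul] at h1
    linarith
  filter_upwards [ae_all_iff.2 key] with x hx c hc
  obtain ⟨m, hm⟩ := exists_nat_one_div_lt (sub_pos.2 hc)
  obtain ⟨K, hK⟩ := hx m
  have h2 : Tendsto (fun n : ℕ => (∫ x, g x ∂μ + 1 / ((m : ℝ) + 1)) + K / n) atTop
      (𝓝 ((∫ x, g x ∂μ + 1 / ((m : ℝ) + 1)) + 0)) :=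
    tendsto_const_nhds.add (tendsto_const_div_atTop_nhds_zero_nat K)
  have h3 := h2.eventually (gt_mem_nhds (show _ < c by linarith))
  filter_upwards [h3, eventually_gt_atTop 0] with n hn hn0
  refine lt_of_le_of_lt ?_ hn
  have hn0' : (0 : ℝ) < n := by exact_mod_cast hn0
  rw [div_le_iff₀ hn0', add_mul, div_mul_cancel₀ _ hn0'.ne']
  linarith [hK n]

lemma birkhoff_ergodic {α : Type*} [MeasurableSpace α] {μ : Measure α} [IsProbabilityMeasure μ]
    {T : α → α} {g : α → ℝ} (hT : Ergodic T μ) (hgm : Measurable g) (hg : Integrable g μ) :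
    ∀ᵐ x ∂μ, Tendsto (fun n : ℕ => (∑ k ∈ Finset.range n, g (T^[k] x)) / n) atTop
      (𝓝 (∫ x, g x ∂μ)) := by
  filter_upwards [birkhoff_upper hT hgm hg, birkhoff_upper hT hgm.neg hg.neg] with x h1 h2
  rw [tendsto_order]
  refine ⟨fun a ha => ?_, h1⟩
  have h3 := h2 (-a) (by simp only [Pi.neg_apply, integral_neg]; linarith)
  filter_upwards [h3] with n hn
  simp only [Pi.neg_apply, Finset.sum_neg_distrib, neg_div] at hn
  linarith

/-! ### Weak convergence of tilted measures -/

structure GoodConv {A : Type*} [TopologicalSpace A] [MeasurableSpace A]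
    (m : ℕ → Measure A) (m0 : Measure A) (f : A → ℝ) : Prop where
  prob : ∀ n, IsProbabilityMeasure (m n)
  prob0 : IsProbabilityMeasure m0
  cont : Continuous f
  int : ∀ n, Integrable (fun x => Real.exp (f x)) (m n)
  int0 : Integrable (fun x => Real.exp (f x)) m0
  lim : Tendsto (fun n => ∫ x, Real.exp (f x) ∂(m n)) atTop (𝓝 (∫ x, Real.exp (f x) ∂m0))
  weak : ∀ k : BoundedContinuousFunction A ℝ,
    Tendsto (fun n => ∫ x, k x ∂((m n).tilted f)) atTop (𝓝 (∫ x, k x ∂(m0.tilted f)))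

lemma tilted_prod {A B : Type*} [MeasurableSpace A] [MeasurableSpace B]
    (m : Measure A) (m' : Measure B) [IsProbabilityMeasure m] [IsProbabilityMeasure m']
    {f : A → ℝ} {f' : B → ℝ} (hf : Measurable f) (hf' : Measurable f') :
    (m.tilted f).prod (m'.tilted f') = (m.prod m').tilted (fun z => f z.1 + f' z.2) := by
  unfold Measure.tilted
  rw [prod_withDensity (by fun_prop) (by fun_prop)]
  congr 1
  ext z
  rw [← ENNReal.ofReal_mul (by positivity)]
  simp only [Real.exp_add]
  rw [integral_prod_mul (fun x => Real.exp (f x)) (fun x => Real.exp (f' x)), div_mul_div_comm]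

lemma GoodConv.prod {A B : Type*} [TopologicalSpace A] [MeasurableSpace A]
    [TopologicalSpace B] [MeasurableSpace B] [SecondCountableTopology A]
    [SecondCountableTopology B] [TopologicalSpace.PseudoMetrizableSpace A]
    [TopologicalSpace.PseudoMetrizableSpace B]
    [OpensMeasurableSpace A] [OpensMeasurableSpace B]
    {m : ℕ → Measure A} {m0 : Measure A} {f : A → ℝ}
    {m' : ℕ → Measure B} {m0' : Measure B} {f' : B → ℝ}
    (h : GoodConv m m0 f) (h' : GoodConv m' m0' f') :
    GoodConv (fun n => (m n).prod (m' n)) (m0.prod m0') (fun z => f z.1 + f' z.2) := by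
  have := h.prob
  have := h.prob0
  have := h'.prob
  have := h'.prob0
  have hc := h.cont
  have hc' := h'.cont
  refine ⟨fun n => inferInstance, inferInstance, by fun_prop, fun n => ?_, ?_, ?_, ?_⟩
  · simp only [Real.exp_add]
    exact (h.int n).mul_prod (h'.int n)
  · simp only [Real.exp_add]
    exact h.int0.mul_prod h'.int0
  · simp only [Real.exp_add]
    simp_rw [integral_prod_mul (fun x => Real.exp (f x)) (fun x => Real.exp (f' x))]
    exact h.lim.mul h'.lim
  · have p := fun n => isProbabilityMeasure_tilted (h.int n)
    have p0 := isProbabilityMeasure_tilted h.int0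
    have p' := fun n => isProbabilityMeasure_tilted (h'.int n)
    have p0' := isProbabilityMeasure_tilted h'.int0
    let η : ℕ → ProbabilityMeasure A := fun n => ⟨(m n).tilted f, p n⟩
    let η0 : ProbabilityMeasure A := ⟨m0.tilted f, p0⟩
    let η' : ℕ → ProbabilityMeasure B := fun n => ⟨(m' n).tilted f', p' n⟩
    let η0' : ProbabilityMeasure B := ⟨m0'.tilted f', p0'⟩
    have t : Tendsto η atTop (𝓝 η0) :=
      ProbabilityMeasure.tendsto_iff_forall_integral_tendsto.2 h.weak
    have t' : Tendsto η' atTop (𝓝 η0') :=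
      ProbabilityMeasure.tendsto_iff_forall_integral_tendsto.2 h'.weak
    have t2 := (ProbabilityMeasure.continuous_prod.tendsto (η0, η0')).comp (t.prodMk_nhds t')
    have t3 := ProbabilityMeasure.tendsto_iff_forall_integral_tendsto.1 t2
    intro k
    simp only [← tilted_prod _ _ hc.measurable hc'.measurable]
    exact t3 k

lemma GoodConv.tendsto {A : Type*} [TopologicalSpace A] [MeasurableSpace A]
    {m : ℕ → Measure A} {m0 : Measure A} {f : A → ℝ}
    (h : GoodConv m m0 f) {k : A → ℝ} (hk : Continuous k) (C : ℝ)
    (hb : ∀ x, |k x| ≤ C * Real.exp (f x)) :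
    Tendsto (fun n => ∫ x, k x ∂(m n)) atTop (𝓝 (∫ x, k x ∂m0)) := by
  have hc := h.cont
  have := h.prob
  have := h.prob0
  let K : BoundedContinuousFunction A ℝ :=
    BoundedContinuousFunction.ofNormedAddCommGroup (fun x => k x * Real.exp (- f x))
      (by fun_prop) C (fun x => by
        rw [norm_mul, Real.norm_eq_abs, Real.norm_eq_abs, Real.abs_exp]
        calc |k x| * Real.exp (- f x) ≤ C * Real.exp (f x) * Real.exp (- f x) := by
              gcongr; exact hb x
          _ = C := by rw [mul_assoc, ← Real.exp_add]; simp)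
  have key : ∀ (μ : Measure A) [IsProbabilityMeasure μ],
      Integrable (fun x => Real.exp (f x)) μ →
      ∫ x, k x ∂μ = (∫ x, Real.exp (f x) ∂μ) * ∫ x, K x ∂(μ.tilted f) := by
    intro μ _ hi
    have hp := integral_exp_pos hi
    rw [integral_tilted, ← integral_const_mul]
    refine integral_congr_ae (Eventually.of_forall fun x => ?_)
    simp only [K, BoundedContinuousFunction.coe_ofNormedAddCommGroup, smul_eq_mul, Real.exp_neg]
    have := Real.exp_pos (f x)
    field_simp
  simp_rw [fun n => key (m n) (h.int n), key m0 h.int0]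
  exact h.lim.mul (h.weak K)

lemma exists_countable_piSystem (A : Type*) [TopologicalSpace A] [SecondCountableTopology A] :
    ∃ S : Set (Set A), S.Countable ∧ IsPiSystem S ∧ (∀ s ∈ S, IsOpen s) ∧
      (∀ (u : Set A), IsOpen u → ∀ x ∈ u, ∃ s ∈ S, s ∈ 𝓝 x ∧ s ⊆ u) := by
  refine ⟨(fun T : Set (Set A) => ⋂₀ T) '' {T | T.Finite ∧ T ⊆ TopologicalSpace.countableBasis A},
    ?_, ?_, ?_, ?_⟩
  · exact (Set.countable_ofPred_finite_subset
      (TopologicalSpace.countable_countableBasis A)).image _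
  · rintro _ ⟨T, ⟨hT, hT'⟩, rfl⟩ _ ⟨U, ⟨hU, hU'⟩, rfl⟩ -
    exact ⟨T ∪ U, ⟨hT.union hU, Set.union_subset hT' hU'⟩, Set.sInter_union _ _⟩
  · rintro _ ⟨T, ⟨hT, hT'⟩, rfl⟩
    exact hT.isOpen_sInter fun t ht => TopologicalSpace.isOpen_of_mem_countableBasis (hT' ht)
  · intro u hu x hx
    obtain ⟨v, hv, hxv, hvu⟩ :=
      (TopologicalSpace.isBasis_countableBasis A).exists_subset_of_mem_open hx hu
    refine ⟨v, ⟨{v}, ⟨Set.finite_singleton v, by simpa using hv⟩, by simp⟩, ?_, hvu⟩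
    exact (TopologicalSpace.isOpen_of_mem_countableBasis hv).mem_nhds hxv

lemma goodConv_of_piSystem {A : Type*} [TopologicalSpace A] [MeasurableSpace A]
    [SecondCountableTopology A] [OpensMeasurableSpace A]
    [TopologicalSpace.PseudoMetrizableSpace A]
    {S : Set (Set A)} (hS : IsPiSystem S) (hSo : ∀ s ∈ S, IsOpen s)
    (hSb : ∀ (u : Set A), IsOpen u → ∀ x ∈ u, ∃ s ∈ S, s ∈ 𝓝 x ∧ s ⊆ u)
    {m : ℕ → Measure A} {m0 : Measure A} {f : A → ℝ}
    (hm : ∀ n, IsProbabilityMeasure (m n)) (hm0 : IsProbabilityMeasure m0) (hf : Continuous f)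
    (hi : ∀ n, Integrable (fun x => Real.exp (f x)) (m n))
    (hi0 : Integrable (fun x => Real.exp (f x)) m0)
    (hlim : Tendsto (fun n => ∫ x, Real.exp (f x) ∂(m n)) atTop (𝓝 (∫ x, Real.exp (f x) ∂m0)))
    (hlimS : ∀ s ∈ S, Tendsto (fun n => ∫ x, s.indicator (fun x => Real.exp (f x)) x ∂(m n)) atTop
      (𝓝 (∫ x, s.indicator (fun x => Real.exp (f x)) x ∂m0))) :
    GoodConv m m0 f := by
  refine ⟨hm, hm0, hf, hi, hi0, hlim, ?_⟩
  have p := fun n => isProbabilityMeasure_tilted (hi n)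
  have p0 := isProbabilityMeasure_tilted hi0
  let η : ℕ → ProbabilityMeasure A := fun n => ⟨(m n).tilted f, p n⟩
  let η0 : ProbabilityMeasure A := ⟨m0.tilted f, p0⟩
  refine ProbabilityMeasure.tendsto_iff_forall_integral_tendsto.1 (?_ : Tendsto η atTop (𝓝 η0))
  refine hS.tendsto_probabilityMeasure_of_tendsto_of_mem (fun s hs => (hSo s hs).measurableSet)
    hSb fun s hs => ?_
  have hsm := (hSo s hs).measurableSet
  have key : ∀ (μ : Measure A) [IsProbabilityMeasure μ],
      μ.tilted f s = ENNReal.ofReal ((∫ x, s.indicator (fun x => Real.exp (f x)) x ∂μ) /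
        ∫ x, Real.exp (f x) ∂μ) := by
    intro μ _
    rw [tilted_apply_eq_ofReal_integral, integral_indicator hsm, integral_div]
  have h1 : Tendsto (fun n => (η n : Measure A) s) atTop (𝓝 ((η0 : Measure A) s)) := by
    simp only [η, η0, ProbabilityMeasure.coe_mk]
    simp_rw [key]
    exact ENNReal.tendsto_ofReal ((hlimS s hs).div hlim (integral_exp_pos hi0).ne')
  exact (ENNReal.tendsto_toNNReal (measure_ne_top _ _)).comp h1

/-! ### The kernel bound -/

lemma rpow_sub_le {β u v M : ℝ} (h1 : 1 < β) (h2 : β < 2) (hu : 0 ≤ u) (hv : 0 ≤ v)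
    (huM : u ≤ M) (hM : 0 < M) : u ^ β - v ^ β ≤ 2 * |u - v| * M ^ (β - 1) := by
  have hMp : 0 ≤ M ^ (β - 1) := by positivity
  rcases le_total u v with h | h
  · have : u ^ β ≤ v ^ β := Real.rpow_le_rpow hu h (by linarith)
    have : 0 ≤ 2 * |u - v| * M ^ (β - 1) := by positivity
    linarith
  · rcases hu.eq_or_lt with h0 | h0
    · have : v = u := by linarith
      subst this
      simp
    · have hB := one_add_mul_self_le_rpow_one_add (s := v / u - 1)
        (by have : 0 ≤ v / u := by positivity
            linarith) h1.le
      rw [add_sub_cancel, Real.div_rpow hv hu, le_div_iff₀ (by positivity)] at hB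
      have e : u ^ β = u * u ^ (β - 1) := by
        rw [← Real.rpow_one_add' hu (by linarith)]; congr 1; ring
      have e2 : (1 + β * (v / u - 1)) * u ^ β = u ^ β - β * (u - v) * u ^ (β - 1) := by
        rw [e]; field_simp; ring
      rw [e2] at hB
      have hle : u ^ (β - 1) ≤ M ^ (β - 1) := Real.rpow_le_rpow hu huM (by linarith)
      have huv : 0 ≤ u - v := by linarith
      rw [abs_of_nonneg huv]
      calc u ^ β - v ^ β ≤ β * (u - v) * u ^ (β - 1) := by linarith
        _ ≤ 2 * (u - v) * M ^ (β - 1) := by gcongr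

lemma abs_rpow_sub_le {β u v M : ℝ} (h1 : 1 < β) (h2 : β < 2) (hu : 0 ≤ u) (hv : 0 ≤ v)
    (huM : u ≤ M) (hvM : v ≤ M) (hM : 0 < M) :
    |u ^ β - v ^ β| ≤ 2 * |u - v| * M ^ (β - 1) := by
  rw [abs_le]
  have ha := rpow_sub_le h1 h2 hu hv huM hM
  have hb := rpow_sub_le h1 h2 hv hu hvM hM
  rw [abs_sub_comm] at hb
  constructor <;> linarith

/-- the four point kernel -/
def ker4 {X : Type*} [MetricSpace X] (β : ℝ) (a b c e : X) : ℝ :=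
  dist a b ^ β - dist a c ^ β - dist b e ^ β + dist c e ^ β

/-- the weight -/
def wt {X : Type*} [MetricSpace X] (β : ℝ) (x₀ x : X) : ℝ := (1 + dist x x₀) ^ (β / 2)

lemma one_le_wt {X : Type*} [MetricSpace X] {β : ℝ} (h1 : 1 < β) (x₀ x : X) : 1 ≤ wt β x₀ x :=
  Real.one_le_rpow (by have := dist_nonneg (x := x) (y := x₀); linarith) (by linarith)

lemma mul_rpow_aux {β r R : ℝ} (h2 : β < 2) (hr : 0 < r) (hR : r ≤ R) :
    r * R ^ (β - 1) ≤ r ^ (β / 2) * R ^ (β / 2) := by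
  have hR0 : 0 < R := hr.trans_le hR
  have e1 : r = r ^ (β / 2) * r ^ (1 - β / 2) := by
    rw [← Real.rpow_add hr]; simp
  have e2 : R ^ (β / 2) = R ^ (1 - β / 2) * R ^ (β - 1) := by
    rw [← Real.rpow_add hR0]; congr 1; ring
  have h : r ^ (1 - β / 2) ≤ R ^ (1 - β / 2) := Real.rpow_le_rpow hr.le hR (by linarith)
  calc r * R ^ (β - 1) = r ^ (β / 2) * r ^ (1 - β / 2) * R ^ (β - 1) := by rw [← e1]
    _ ≤ r ^ (β / 2) * R ^ (1 - β / 2) * R ^ (β - 1) := by gcongr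
    _ = _ := by rw [e2]; ring

lemma ker4_bound_aux {X : Type*} [MetricSpace X] {β : ℝ} (h1 : 1 < β) (h2 : β < 2) (x₀ a b c e : X)
    (hb : dist b x₀ ≤ dist a x₀) (hc : dist c x₀ ≤ dist a x₀) (he : dist e x₀ ≤ dist a x₀) :
    |ker4 β a b c e| ≤ 16 * (wt β x₀ a * wt β x₀ b * wt β x₀ c * wt β x₀ e) := by
  set R := 1 + dist a x₀ with hR
  have ha0 := dist_nonneg (x := a) (y := x₀)
  have hb0 := dist_nonneg (x := b) (y := x₀)
  have hc0 := dist_nonneg (x := c) (y := x₀)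
  have hab := dist_triangle_right a b x₀
  have hac := dist_triangle_right a c x₀
  have hbe := dist_triangle_right b e x₀
  have hce := dist_triangle_right c e x₀
  have hbc := dist_triangle_right b c x₀
  have k1 : |dist a b ^ β - dist a c ^ β| ≤ 2 * |dist a b - dist a c| * (2 * R) ^ (β - 1) :=
    abs_rpow_sub_le h1 h2 dist_nonneg dist_nonneg (by linarith) (by linarith) (by linarith)
  have k2 : |dist c e ^ β - dist b e ^ β| ≤ 2 * |dist c e - dist b e| * (2 * R) ^ (β - 1) :=
    abs_rpow_sub_le h1 h2 dist_nonneg dist_nonneg (by linarith) (by linarith) (by linarith)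
  have d1 : |dist a b - dist a c| ≤ (1 + dist b x₀) + (1 + dist c x₀) := by
    rw [dist_comm a b, dist_comm a c]
    exact (abs_dist_sub_le b c a).trans (by linarith)
  have d2 : |dist c e - dist b e| ≤ (1 + dist b x₀) + (1 + dist c x₀) := by
    refine (abs_dist_sub_le c b e).trans ?_
    rw [dist_comm c b]; linarith
  have p2 : (2 * R) ^ (β - 1) ≤ 2 * R ^ (β - 1) := by
    rw [Real.mul_rpow (by norm_num) (by linarith)]
    gcongr
    calc (2 : ℝ) ^ (β - 1) ≤ 2 ^ (1 : ℝ) :=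
          Real.rpow_le_rpow_of_exponent_le (by norm_num) (by linarith)
      _ = 2 := by simp
  have hRp : 0 ≤ R ^ (β - 1) := by positivity
  have e0 : |ker4 β a b c e| ≤
      |dist a b ^ β - dist a c ^ β| + |dist c e ^ β - dist b e ^ β| := by
    have : ker4 β a b c e = (dist a b ^ β - dist a c ^ β) + (dist c e ^ β - dist b e ^ β) := by
      unfold ker4; ring
    rw [this]; exact abs_add_le _ _
  have e1 : |dist a b ^ β - dist a c ^ β| ≤
      2 * ((1 + dist b x₀) + (1 + dist c x₀)) * (2 * R ^ (β - 1)) := k1.trans (by gcongr)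
  have e2 : |dist c e ^ β - dist b e ^ β| ≤
      2 * ((1 + dist b x₀) + (1 + dist c x₀)) * (2 * R ^ (β - 1)) := k2.trans (by gcongr)
  have f1 : (1 + dist b x₀) * R ^ (β - 1) ≤ wt β x₀ b * wt β x₀ a :=
    mul_rpow_aux h2 (by linarith) (by linarith)
  have f2 : (1 + dist c x₀) * R ^ (β - 1) ≤ wt β x₀ c * wt β x₀ a :=
    mul_rpow_aux h2 (by linarith) (by linarith)
  have wa := one_le_wt h1 x₀ a
  have wb := one_le_wt h1 x₀ b
  have wc := one_le_wt h1 x₀ c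
  have we := one_le_wt h1 x₀ e
  set A := wt β x₀ a
  set B := wt β x₀ b
  set C := wt β x₀ c
  set E := wt β x₀ e
  have g1 : B * A ≤ A * B * C * E := by
    have : 1 ≤ C * E := one_le_mul_of_one_le_of_one_le wc we
    calc B * A = A * B * 1 := by ring
      _ ≤ A * B * (C * E) := by gcongr
      _ = _ := by ring
  have g2 : C * A ≤ A * B * C * E := by
    have : 1 ≤ B * E := one_le_mul_of_one_le_of_one_le wb we
    calc C * A = A * C * 1 := by ring
      _ ≤ A * C * (B * E) := by gcongr
      _ = _ := by ring
  nlinarith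

lemma ker4_bound {X : Type*} [MetricSpace X] {β : ℝ} (h1 : 1 < β) (h2 : β < 2) (x₀ a b c e : X) :
    |ker4 β a b c e| ≤ 16 * (wt β x₀ a * wt β x₀ b * wt β x₀ c * wt β x₀ e) := by
  have s1 : ker4 β a b c e = ker4 β b a e c := by
    unfold ker4; rw [dist_comm b a, dist_comm e c]; ring
  have s2 : ker4 β a b c e = ker4 β c e a b := by
    unfold ker4; rw [dist_comm c a, dist_comm e b]; ring
  have s3 : ker4 β a b c e = ker4 β e c b a := by
    unfold ker4; rw [dist_comm e c, dist_comm e b, dist_comm c a, dist_comm b a]; ring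
  rcases le_total (dist a x₀) (dist b x₀) with hab | hab <;>
  rcases le_total (dist c x₀) (dist e x₀) with hce | hce
  · rcases le_total (dist b x₀) (dist e x₀) with h | h
    · rw [s3]
      refine (ker4_bound_aux h1 h2 x₀ e c b a hce h (hab.trans h)).trans (le_of_eq ?_); ring
    · rw [s1]
      refine (ker4_bound_aux h1 h2 x₀ b a e c hab h (hce.trans h)).trans (le_of_eq ?_); ring
  · rcases le_total (dist b x₀) (dist c x₀) with h | h
    · rw [s2]
      refine (ker4_bound_aux h1 h2 x₀ c e a b hce (hab.trans h) h).trans (le_of_eq ?_); ring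
    · rw [s1]
      refine (ker4_bound_aux h1 h2 x₀ b a e c hab (hce.trans h) h).trans (le_of_eq ?_); ring
  · rcases le_total (dist a x₀) (dist e x₀) with h | h
    · rw [s3]
      refine (ker4_bound_aux h1 h2 x₀ e c b a hce (hab.trans h) h).trans (le_of_eq ?_); ring
    · exact ker4_bound_aux h1 h2 x₀ a b c e hab (hce.trans h) h
  · rcases le_total (dist a x₀) (dist c x₀) with h | h
    · rw [s2]
      refine (ker4_bound_aux h1 h2 x₀ c e a b hce h (hab.trans h)).trans (le_of_eq ?_); ring
    · exact ker4_bound_aux h1 h2 x₀ a b c e hab h (hce.trans h)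

lemma wt_sq {X : Type*} [MetricSpace X] (β : ℝ) (x₀ x : X) :
    wt β x₀ x ^ 2 = (1 + dist x x₀) ^ β := by
  unfold wt
  rw [← Real.rpow_natCast, ← Real.rpow_mul (by positivity)]
  congr 1; push_cast; ring

lemma add_rpow_le {β u v : ℝ} (h1 : 1 < β) (h2 : β < 2) (hu : 0 ≤ u) (hv : 0 ≤ v) :
    (u + v) ^ β ≤ 4 * (u ^ β + v ^ β) := by
  have hm : 0 ≤ max u v := le_max_of_le_left hu
  have e : (2 : ℝ) ^ β ≤ 4 := by
    calc (2 : ℝ) ^ β ≤ 2 ^ (2 : ℝ) :=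
          Real.rpow_le_rpow_of_exponent_le (by norm_num) (by linarith)
      _ = 4 := by norm_num
  have e2 : (max u v) ^ β ≤ u ^ β + v ^ β := by
    have := Real.rpow_nonneg hu β
    have := Real.rpow_nonneg hv β
    rcases max_choice u v with h | h <;> rw [h] <;> linarith
  calc (u + v) ^ β ≤ (2 * max u v) ^ β :=
        Real.rpow_le_rpow (by positivity) (by
          have := le_max_left u v
          have := le_max_right u v
          linarith) (by linarith)
    _ = 2 ^ β * (max u v) ^ β := Real.mul_rpow (by norm_num) hm
    _ ≤ 4 * (u ^ β + v ^ β) := by gcongr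

lemma dist_rpow_le {X : Type*} [MetricSpace X] {β : ℝ} (h1 : 1 < β) (h2 : β < 2) (x₀ a b : X) :
    dist a b ^ β ≤ 4 * (wt β x₀ a ^ 2 + wt β x₀ b ^ 2) := by
  rw [wt_sq, wt_sq]
  refine le_trans ?_ (add_rpow_le h1 h2 (by positivity) (by positivity))
  refine Real.rpow_le_rpow dist_nonneg ?_ (by linarith)
  have := dist_triangle_right a b x₀
  linarith

lemma continuous_wt {X : Type*} [MetricSpace X] {β : ℝ} (h1 : 1 < β) (x₀ : X) :
    Continuous (wt β x₀) := by
  unfold wt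
  exact Continuous.rpow_const (by fun_prop) (fun x => Or.inr (by linarith))

lemma continuous_dist_rpow {X A : Type*} [MetricSpace X] [TopologicalSpace A] {β : ℝ} (h1 : 1 < β)
    {f g : A → X} (hf : Continuous f) (hg : Continuous g) :
    Continuous (fun x => dist (f x) (g x) ^ β) :=
  Continuous.rpow_const (by fun_prop) (fun x => Or.inr (by linarith))

lemma integrable_wt_sq {X : Type*} [MetricSpace X] [SecondCountableTopology X] [MeasurableSpace X]
    [BorelSpace X] {β : ℝ} (h1 : 1 < β) (h2 : β < 2) (x₀ : X) (μ : Measure X)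
    [IsProbabilityMeasure μ] (h : Integrable (fun x => dist x x₀ ^ β) μ) :
    Integrable (fun x => wt β x₀ x ^ 2) μ := by
  have hi : Integrable (fun x => 4 * ((1 : ℝ) ^ β + dist x x₀ ^ β)) μ :=
    ((integrable_const _).add h).const_mul 4
  refine hi.mono' ((continuous_wt h1 x₀).pow 2).aestronglyMeasurable ?_
  refine Eventually.of_forall fun x => ?_
  rw [Real.norm_of_nonneg (by positivity), wt_sq]
  exact add_rpow_le h1 h2 zero_le_one dist_nonneg

/-! ### Representation of `dcov` as an integral of a kernel in six variables -/

lemma dM_eq {X : Type*} [MetricSpace X] [SecondCountableTopology X] [MeasurableSpace X]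
    [BorelSpace X] {β : ℝ} (h1 : 1 < β) (h2 : β < 2) (x₀ : X) (μ : Measure X)
    [IsProbabilityMeasure μ] (h : Integrable (fun x => wt β x₀ x ^ 2) μ) (x x' : X) :
    dM (fun a b : X => dist a b ^ β) μ x x' = ∫ q : X × X, ker4 β x x' q.1 q.2 ∂(μ.prod μ) := by
  have i1 : ∀ y : X, Integrable (fun u => dist y u ^ β) μ := by
    intro y
    have hi : Integrable (fun u => 4 * (wt β x₀ y ^ 2 + wt β x₀ u ^ 2)) μ :=
      ((integrable_const _).add h).const_mul 4
    refine hi.mono'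
      (continuous_dist_rpow h1 continuous_const continuous_id).aestronglyMeasurable ?_
    refine Eventually.of_forall fun u => ?_
    rw [Real.norm_of_nonneg (by positivity)]
    exact dist_rpow_le h1 h2 x₀ y u
  have i2 : Integrable (fun q : X × X => dist q.1 q.2 ^ β) (μ.prod μ) := by
    have hi : Integrable (fun q : X × X => 4 * (wt β x₀ q.1 ^ 2 + wt β x₀ q.2 ^ 2)) (μ.prod μ) :=
      ((h.comp_fst μ).add (h.comp_snd μ)).const_mul 4
    refine hi.mono'
      (continuous_dist_rpow h1 continuous_fst continuous_snd).aestronglyMeasurable ?_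
    refine Eventually.of_forall fun u => ?_
    rw [Real.norm_of_nonneg (by positivity)]
    exact dist_rpow_le h1 h2 x₀ _ _
  have j1 : Integrable (fun q : X × X => dist x q.1 ^ β) (μ.prod μ) := (i1 x).comp_fst μ
  have j2 : Integrable (fun q : X × X => dist x' q.2 ^ β) (μ.prod μ) := (i1 x').comp_snd μ
  have e1 : ∫ q : X × X, dist x q.1 ^ β ∂(μ.prod μ) = ∫ u, dist x u ^ β ∂μ := by
    have := integral_fun_fst (μ := μ) (ν := μ) (fun u => dist x u ^ β)
    simpa using this
  have e2 : ∫ q : X × X, dist x' q.2 ^ β ∂(μ.prod μ) = ∫ u, dist x' u ^ β ∂μ := by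
    have := integral_fun_snd (μ := μ) (ν := μ) (fun u => dist x' u ^ β)
    simpa using this
  unfold dM aM DM ker4
  have j0 : Integrable (fun q : X × X => dist x x' ^ β) (μ.prod μ) := integrable_const _
  have j01 : Integrable (fun q : X × X => dist x x' ^ β - dist x q.1 ^ β) (μ.prod μ) := j0.sub j1
  have j012 : Integrable (fun q : X × X => dist x x' ^ β - dist x q.1 ^ β - dist x' q.2 ^ β)
    (μ.prod μ) := j01.sub j2
  rw [integral_add j012 i2, integral_sub j01 j2, integral_sub j0 j1, e1, e2]
  simp

/-- the six variable kernel -/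
def ker6 {X Y : Type*} [MetricSpace X] [MetricSpace Y] (β : ℝ)
    (w : ((X × Y) × (X × Y)) × (((X × Y) × (X × Y)) × ((X × Y) × (X × Y)))) : ℝ :=
  ker4 β w.1.1.1 w.1.2.1 w.2.1.1.1 w.2.1.2.1 * ker4 β w.1.1.2 w.1.2.2 w.2.2.1.2 w.2.2.2.2

/-- the weight on the product space -/
def wt2 {X Y : Type*} [MetricSpace X] [MetricSpace Y] (β : ℝ) (x₀ : X) (y₀ : Y) (z : X × Y) : ℝ :=
  wt β x₀ z.1 * wt β y₀ z.2

lemma ker6_bound {X Y : Type*} [MetricSpace X] [MetricSpace Y] {β : ℝ} (h1 : 1 < β) (h2 : β < 2)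
    (x₀ : X) (y₀ : Y) (w : ((X × Y) × (X × Y)) × (((X × Y) × (X × Y)) × ((X × Y) × (X × Y)))) :
    |ker6 β w| ≤ 256 * ((wt2 β x₀ y₀ w.1.1 * wt2 β x₀ y₀ w.1.2) *
      ((wt2 β x₀ y₀ w.2.1.1 * wt2 β x₀ y₀ w.2.1.2) *
        (wt2 β x₀ y₀ w.2.2.1 * wt2 β x₀ y₀ w.2.2.2))) := by
  obtain ⟨⟨⟨a1, b1⟩, ⟨a2, b2⟩⟩, ⟨⟨⟨a3, b3⟩, ⟨a4, b4⟩⟩, ⟨⟨a5, b5⟩, ⟨a6, b6⟩⟩⟩⟩ := w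
  simp only [ker6, wt2, abs_mul]
  have k1 := ker4_bound h1 h2 x₀ a1 a2 a3 a4
  have k2 := ker4_bound h1 h2 y₀ b1 b2 b5 b6
  have w1 := one_le_wt h1 x₀ a1
  have w2 := one_le_wt h1 x₀ a2
  have w3 := one_le_wt h1 x₀ a3
  have w4 := one_le_wt h1 x₀ a4
  have w5 := one_le_wt h1 x₀ a5
  have w6 := one_le_wt h1 x₀ a6
  have v1 := one_le_wt h1 y₀ b1
  have v2 := one_le_wt h1 y₀ b2
  have v3 := one_le_wt h1 y₀ b3
  have v4 := one_le_wt h1 y₀ b4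
  have v5 := one_le_wt h1 y₀ b5
  have v6 := one_le_wt h1 y₀ b6
  refine (mul_le_mul k1 k2 (abs_nonneg _) (by positivity)).trans ?_
  have t : 1 ≤ (wt β x₀ a5 * wt β x₀ a6) * (wt β y₀ b3 * wt β y₀ b4) :=
    one_le_mul_of_one_le_of_one_le (one_le_mul_of_one_le_of_one_le w5 w6)
      (one_le_mul_of_one_le_of_one_le v3 v4)
  have pos : 0 ≤ 16 * (wt β x₀ a1 * wt β x₀ a2 * wt β x₀ a3 * wt β x₀ a4) *
    (16 * (wt β y₀ b1 * wt β y₀ b2 * wt β y₀ b5 * wt β y₀ b6)) := by positivity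
  refine (le_mul_of_one_le_right pos t).trans (le_of_eq ?_)
  ring

lemma continuous_ker6 {X Y : Type*} [MetricSpace X] [MetricSpace Y] {β : ℝ} (h1 : 1 < β) :
    Continuous (ker6 (X := X) (Y := Y) β) := by
  unfold ker6 ker4
  have := h1
  refine Continuous.mul (((Continuous.sub ?_ ?_).sub ?_).add ?_)
    (((Continuous.sub ?_ ?_).sub ?_).add ?_) <;>
  exact continuous_dist_rpow h1 (by fun_prop) (by fun_prop)

lemma continuous_ker4 {X A : Type*} [MetricSpace X] [TopologicalSpace A] {β : ℝ} (h1 : 1 < β)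
    {f1 f2 f3 f4 : A → X} (hf1 : Continuous f1) (hf2 : Continuous f2) (hf3 : Continuous f3)
    (hf4 : Continuous f4) :
    Continuous (fun x => ker4 β (f1 x) (f2 x) (f3 x) (f4 x)) := by
  unfold ker4
  refine ((Continuous.sub ?_ ?_).sub ?_).add ?_ <;> exact continuous_dist_rpow h1 ‹_› ‹_›

lemma integrable_wt2 {X Y : Type*} [MetricSpace X] [MetricSpace Y] [SecondCountableTopology X]
    [MeasurableSpace X] [BorelSpace X] [SecondCountableTopology Y]
    [MeasurableSpace Y] [BorelSpace Y] {β : ℝ} (h1 : 1 < β)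
    (x₀ : X) (y₀ : Y) (θ : Measure (X × Y))
    (hX : Integrable (fun z => wt β x₀ z.1 ^ 2) θ)
    (hY : Integrable (fun z => wt β y₀ z.2 ^ 2) θ) : Integrable (wt2 β x₀ y₀) θ := by
  have c : Continuous (wt2 β x₀ y₀) :=
    ((continuous_wt h1 x₀).comp continuous_fst).mul ((continuous_wt h1 y₀).comp continuous_snd)
  refine (hX.add hY).mono' c.aestronglyMeasurable (Eventually.of_forall fun z => ?_)
  have w1 := one_le_wt h1 x₀ z.1
  have w2 := one_le_wt h1 y₀ z.2
  unfold wt2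
  rw [Real.norm_of_nonneg (by positivity)]
  simp only [Pi.add_apply]
  nlinarith [sq_nonneg (wt β x₀ z.1 - wt β y₀ z.2)]

lemma dcov_eq {X Y : Type*} [MetricSpace X] [MetricSpace Y] [SecondCountableTopology X]
    [MeasurableSpace X] [BorelSpace X] [SecondCountableTopology Y]
    [MeasurableSpace Y] [BorelSpace Y] {β : ℝ} (h1 : 1 < β) (h2 : β < 2)
    (x₀ : X) (y₀ : Y) (θ : Measure (X × Y)) [IsProbabilityMeasure θ]
    (hX : Integrable (fun z => wt β x₀ z.1 ^ 2) θ)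
    (hY : Integrable (fun z => wt β y₀ z.2 ^ 2) θ) :
    dcov (fun a b : X => dist a b ^ β) (fun a b : Y => dist a b ^ β) θ =
      ∫ w, ker6 β w ∂((θ.prod θ).prod ((θ.prod θ).prod (θ.prod θ))) := by
  have pX : IsProbabilityMeasure (θ.map Prod.fst) :=
    Measure.isProbabilityMeasure_map measurable_fst.aemeasurable
  have pY : IsProbabilityMeasure (θ.map Prod.snd) :=
    Measure.isProbabilityMeasure_map measurable_snd.aemeasurable
  have hX' : Integrable (fun x => wt β x₀ x ^ 2) (θ.map Prod.fst) :=
    (integrable_map_measure ((continuous_wt h1 x₀).pow 2).aestronglyMeasurable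
      measurable_fst.aemeasurable).2 hX
  have hY' : Integrable (fun x => wt β y₀ x ^ 2) (θ.map Prod.snd) :=
    (integrable_map_measure ((continuous_wt h1 y₀).pow 2).aestronglyMeasurable
      measurable_snd.aemeasurable).2 hY
  have hF := integrable_wt2 h1 x₀ y₀ θ hX hY
  have hF2 := hF.mul_prod hF
  have hF6 := hF2.mul_prod (hF2.mul_prod hF2)
  have hker : Integrable (ker6 β) ((θ.prod θ).prod ((θ.prod θ).prod (θ.prod θ))) := by
    refine (hF6.const_mul 256).mono' (continuous_ker6 h1).aestronglyMeasurable
      (Eventually.of_forall fun w => ?_)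
    exact ker6_bound h1 h2 x₀ y₀ w
  rw [integral_prod _ hker]
  unfold dcov deltaTheta
  refine integral_congr_ae (Eventually.of_forall fun p => ?_)
  simp only
  rw [dM_eq h1 h2 x₀ _ hX', dM_eq h1 h2 y₀ _ hY',
    Measure.map_prod_map _ _ measurable_fst measurable_fst,
    Measure.map_prod_map _ _ measurable_snd measurable_snd,
    integral_map (by fun_prop) (continuous_ker4 h1 continuous_const continuous_const
      continuous_fst continuous_snd).aestronglyMeasurable,
    integral_map (by fun_prop) (continuous_ker4 h1 continuous_const continuous_const
      continuous_fst continuous_snd).aestronglyMeasurable,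
    ← integral_prod_mul]
  rfl

/-! ### Empirical measures -/

lemma integral_emp {Ω W : Type*} [MeasurableSpace W] (Z : ℕ → Ω → W) (n : ℕ) (ω : Ω)
    {g : W → ℝ} (hg : Measurable g) :
    ∫ z, g z ∂(emp Z n ω) = (∑ k ∈ Finset.range n, g (Z k ω)) / n := by
  unfold emp
  rw [integral_smul_measure, integral_finsetSum_measure
    (fun i _ => integrable_dirac' hg.stronglyMeasurable (by simp))]
  simp_rw [integral_dirac' _ _ hg.stronglyMeasurable]
  simp [div_eq_inv_mul]

lemma integrable_emp {Ω W : Type*} [MeasurableSpace W] (Z : ℕ → Ω → W) (n : ℕ) (ω : Ω)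
    {g : W → ℝ} (hg : Measurable g) : Integrable g (emp Z (n + 1) ω) := by
  unfold emp
  refine Integrable.smul_measure ?_ (by simp)
  exact integrable_finsetSum_measure.2
    (fun i _ => integrable_dirac' hg.stronglyMeasurable (by simp))

lemma prob_emp {Ω W : Type*} [MeasurableSpace W] (Z : ℕ → Ω → W) (n : ℕ) (ω : Ω) :
    IsProbabilityMeasure (emp Z (n + 1) ω) := by
  constructor
  unfold emp
  simp only [Measure.smul_apply, Measure.finsetSum_apply, measure_univ, Finset.sum_const,
    Finset.card_range, nsmul_eq_mul, mul_one, smul_eq_mul]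
  exact ENNReal.inv_mul_cancel (by simp) (by simp)

lemma shift_iterate {W : Type*} (k : ℕ) (x : ℕ → W) (i : ℕ) : (shift^[k] x) i = x (i + k) := by
  induction k generalizing x with
  | zero => rfl
  | succ k ih => rw [Function.iterate_succ_apply, ih]; unfold shift; congr 1

lemma slln {Ω W : Type*} [MeasurableSpace W] [MeasurableSpace Ω] {P : Measure Ω}
    [IsProbabilityMeasure P] {Z : ℕ → Ω → W} (hZ : ∀ i, Measurable (Z i))
    (herg : Ergodic shift (P.map fun ω i => Z i ω)) {g : W → ℝ} (hg : Measurable g)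
    (hi : Integrable g (P.map (Z 0))) :
    ∀ᵐ ω ∂P, Tendsto (fun n => ∫ z, g z ∂(emp Z n ω)) atTop (𝓝 (∫ z, g z ∂(P.map (Z 0)))) := by
  have hm : Measurable (fun ω i => Z i ω) := measurable_pi_lambda _ hZ
  have := Measure.isProbabilityMeasure_map (μ := P) hm.aemeasurable
  have hg0 : Measurable (fun x : ℕ → W => g (x 0)) := hg.comp (measurable_pi_apply 0)
  have hi' : Integrable (fun ω => g (Z 0 ω)) P :=
    (integrable_map_measure hg.aestronglyMeasurable (hZ 0).aemeasurable).1 hi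
  have hi0 : Integrable (fun x : ℕ → W => g (x 0)) (P.map fun ω i => Z i ω) :=
    (integrable_map_measure hg0.aestronglyMeasurable hm.aemeasurable).2 hi'
  have hb := ae_of_ae_map hm.aemeasurable (birkhoff_ergodic herg hg0 hi0)
  rw [integral_map hm.aemeasurable hg0.aestronglyMeasurable] at hb
  rw [integral_map (hZ 0).aemeasurable hg.aestronglyMeasurable]
  filter_upwards [hb] with ω hω
  simp_rw [integral_emp Z _ ω hg]
  simpa only [shift_iterate, zero_add] using hω

/-- For `β ∈ (1,2)`, if `X, Y` have finite `β`-moments and `(Z_k)` is strictly stationary and ergodic, then `dcov_β(θₙ) → dcov_β(θ)` almost surely. -/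
theorem dcovBeta_strong_consistency_one_lt_beta
    (β : ℝ) (hβ : β ∈ Set.Ioo (1 : ℝ) 2)
    {X Y : Type*}
    [MetricSpace X] [TopologicalSpace.SeparableSpace X] [MeasurableSpace X] [BorelSpace X]
    [MetricSpace Y] [TopologicalSpace.SeparableSpace Y] [MeasurableSpace Y] [BorelSpace Y]
    {Ω : Type*} [MeasurableSpace Ω] (P : Measure Ω) [IsProbabilityMeasure P]
    (Z : ℕ → Ω → X × Y) (hZmeas : ∀ i, Measurable (Z i))
    -- strict stationarity and ergodicity of the process
    (hstat : MeasurePreserving shift (P.map fun ω i => Z i ω) (P.map fun ω i => Z i ω))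
    (herg : Ergodic shift (P.map fun ω i => Z i ω))
    (θ : Measure (X × Y)) (hθ : θ = P.map (Z 0))
    -- finite β-moments
    (x₀ : X) (y₀ : Y)
    (hmomX : Integrable (fun x => dist x x₀ ^ (β : ℝ)) (θ.map Prod.fst))
    (hmomY : Integrable (fun y => dist y y₀ ^ (β : ℝ)) (θ.map Prod.snd)) :
    ∀ᵐ ω ∂P, Tendsto
      (fun n => dcov (fun a b : X => dist a b ^ β) (fun a b : Y => dist a b ^ β)
        (emp Z n ω))
      atTop
      (𝓝 (dcov (fun a b : X => dist a b ^ β) (fun a b : Y => dist a b ^ β) θ)) := by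
  obtain ⟨h1, h2⟩ := hβ
  have : SecondCountableTopology X := UniformSpace.secondCountable_of_separable X
  have : SecondCountableTopology Y := UniformSpace.secondCountable_of_separable Y
  have pθ : IsProbabilityMeasure θ := by
    rw [hθ]; exact Measure.isProbabilityMeasure_map (hZmeas 0).aemeasurable
  have pX : IsProbabilityMeasure (θ.map Prod.fst) :=
    Measure.isProbabilityMeasure_map measurable_fst.aemeasurable
  have pY : IsProbabilityMeasure (θ.map Prod.snd) :=
    Measure.isProbabilityMeasure_map measurable_snd.aemeasurable
  have cX : Continuous (fun z : X × Y => wt β x₀ z.1 ^ 2) :=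
    ((continuous_wt h1 x₀).comp continuous_fst).pow 2
  have cY : Continuous (fun z : X × Y => wt β y₀ z.2 ^ 2) :=
    ((continuous_wt h1 y₀).comp continuous_snd).pow 2
  have hX : Integrable (fun z => wt β x₀ z.1 ^ 2) θ :=
    (integrable_map_measure ((continuous_wt h1 x₀).pow 2).aestronglyMeasurable
      measurable_fst.aemeasurable).1 (integrable_wt_sq h1 h2 x₀ _ hmomX)
  have hY : Integrable (fun z => wt β y₀ z.2 ^ 2) θ :=
    (integrable_map_measure ((continuous_wt h1 y₀).pow 2).aestronglyMeasurable
      measurable_snd.aemeasurable).1 (integrable_wt_sq h1 h2 y₀ _ hmomY)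
  have cF : Continuous (wt2 β x₀ y₀) :=
    ((continuous_wt h1 x₀).comp continuous_fst).mul ((continuous_wt h1 y₀).comp continuous_snd)
  have Fpos : ∀ z, 0 < wt2 β x₀ y₀ z := fun z =>
    mul_pos (zero_lt_one.trans_le (one_le_wt h1 x₀ z.1))
      (zero_lt_one.trans_le (one_le_wt h1 y₀ z.2))
  have hF := integrable_wt2 h1 x₀ y₀ θ hX hY
  set f : X × Y → ℝ := fun z => Real.log (wt2 β x₀ y₀ z) with hf
  have cf : Continuous f := cF.log fun z => (Fpos z).ne'
  have ef : (fun z => Real.exp (f z)) = wt2 β x₀ y₀ := by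
    ext z; exact Real.exp_log (Fpos z)
  obtain ⟨S, hSc, hSpi, hSo, hSb⟩ := exists_countable_piSystem (X × Y)
  have a1 : ∀ᵐ ω ∂P, Tendsto (fun n => ∫ z, wt2 β x₀ y₀ z ∂(emp Z n ω)) atTop
      (𝓝 (∫ z, wt2 β x₀ y₀ z ∂θ)) := by
    rw [hθ] at hF ⊢
    exact slln hZmeas herg cF.measurable hF
  have a2 : ∀ᵐ ω ∂P, ∀ s ∈ S, Tendsto
      (fun n => ∫ z, s.indicator (wt2 β x₀ y₀) z ∂(emp Z n ω)) atTop
      (𝓝 (∫ z, s.indicator (wt2 β x₀ y₀) z ∂θ)) := by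
    rw [ae_ball_iff hSc]
    intro s hs
    have hsm := (hSo s hs).measurableSet
    rw [hθ] at hF ⊢
    exact slln hZmeas herg (cF.measurable.indicator hsm) (hF.indicator hsm)
  filter_upwards [a1, a2] with ω b1 b2
  rw [← tendsto_add_atTop_iff_nat 1]
  have pe := fun n => prob_emp Z n ω
  have G : GoodConv (fun n => emp Z (n + 1) ω) θ f := by
    refine goodConv_of_piSystem hSpi hSo hSb pe pθ cf ?_ ?_ ?_ ?_
    · intro n; rw [ef]; exact integrable_emp Z n ω cF.measurable
    · rw [ef]; exact hF
    · simp only [← ef] at b1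
      exact (tendsto_add_atTop_iff_nat 1).2 b1
    · intro s hs
      rw [ef]
      exact (tendsto_add_atTop_iff_nat 1).2 (b2 s hs)
  have G2 := G.prod G
  have G6 := G2.prod (G2.prod G2)
  have T := G6.tendsto (continuous_ker6 (X := X) (Y := Y) h1) 256 (fun w => by
    refine (ker6_bound h1 h2 x₀ y₀ w).trans (le_of_eq ?_)
    simp only [Real.exp_add, ← ef])
  rw [dcov_eq h1 h2 x₀ y₀ θ hX hY]
  refine T.congr fun n => ?_
  have := pe n
  exact (dcov_eq h1 h2 x₀ y₀ _ (integrable_emp Z n ω cX.measurable)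
    (integrable_emp Z n ω cY.measurable)).symm
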